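/- arXiv:0911.4113 — 5 statements merged into one kernel-verified Lean document; each statement's English description precedes it below -/
import Mathlib

section
/- Let k, n be positive integers and let A, B be unital ℂ-subalgebras of M_n(ℂ) that are closed under conjugate transpose and are each isomorphic to M_k(ℂ) as star-algebras (i.e., there exist star-algebra isomorphisms M_k(ℂ) ≅ A and M_k(ℂ) ≅ B). Then there exists a unitary matrix u ∈ U(n) such that B = { u * a * uᴴ : a ∈ A }. (This is the transitivity statement, via the Noether–Skolem theorem, underlying the paper's identification of the matrix grassmannian Gr_{k,l} = PU(kl)/(PU(k) ⊗ PU(l)) as the space of k-subalgebras of M_{kl}(ℂ).) -/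
open Matrix in
theorem aux_proj_conj {n : ℕ} (p q : Matrix (Fin n) (Fin n) ℂ)
    (hp : p.IsHermitian) (hq : q.IsHermitian) (hpp : p * p = p) (hqq : q * q = q)
    (ht : p.trace = q.trace) :
    ∃ v : Matrix (Fin n) (Fin n) ℂ, star v * v = 1 ∧ v * star v = 1 ∧ v * p = q * v := by
  have key : ∀ (r : Matrix (Fin n) (Fin n) ℂ) (hr : r.IsHermitian), r * r = r →
      ∃ m : ℕ, m ≤ n ∧ r.trace = (m : ℂ) ∧
        r.charpoly = (Polynomial.X - Polynomial.C 1) ^ m * Polynomial.X ^ (n - m) := by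
    intro r hr hrr
    have h01 : ∀ i, hr.eigenvalues i = 0 ∨ hr.eigenvalues i = 1 := by
      intro i
      have h := hr.eigenvalues_mem_spectrum_real i
      have h2 := IsIdempotentElem.spectrum_subset ℝ (show IsIdempotentElem r from hrr) h
      simpa using h2
    have hc : (Finset.univ.filter (fun i => ¬ hr.eigenvalues i = 1)).card
        = n - (Finset.univ.filter (fun i => hr.eigenvalues i = 1)).card := by
      have := Finset.card_filter_add_card_filter_not (s := (Finset.univ : Finset (Fin n)))
        (fun i => hr.eigenvalues i = 1)
      simp only [Finset.card_univ, Fintype.card_fin] at this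
      omega
    refine ⟨(Finset.univ.filter (fun i => hr.eigenvalues i = 1)).card, ?_, ?_, ?_⟩
    · simpa using Finset.card_filter_le (Finset.univ : Finset (Fin n)) (fun i => hr.eigenvalues i = 1)
    · rw [hr.trace_eq_sum_eigenvalues, Finset.card_filter]
      push_cast
      refine Finset.sum_congr rfl fun i _ => ?_
      rcases h01 i with h | h <;> simp [h]
    · rw [hr.charpoly_eq, ← hc, ← Finset.prod_const, ← Finset.prod_const, ← Finset.prod_ite]
      refine Finset.prod_congr rfl fun i _ => ?_
      rcases h01 i with h | h <;> simp [h]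
  obtain ⟨a, -, hat, hac⟩ := key p hp hpp
  obtain ⟨b, -, hbt, hbc⟩ := key q hq hqq
  have hab : a = b := by
    rw [hat, hbt] at ht
    exact_mod_cast ht
  subst hab
  have he := (hp.eigenvalues_eq_eigenvalues_iff hq).2 (hac.trans hbc.symm)
  have h1 := hp.spectral_theorem
  have h2 := hq.spectral_theorem
  rw [Unitary.conjStarAlgAut_apply] at h1 h2
  rw [he] at h1
  set U : Matrix (Fin n) (Fin n) ℂ := (hp.eigenvectorUnitary).1
  set V : Matrix (Fin n) (Fin n) ℂ := (hq.eigenvectorUnitary).1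
  have hU1 : star U * U = 1 := Unitary.coe_star_mul_self _
  have hU2 : U * star U = 1 := Unitary.coe_mul_star_self _
  have hV1 : star V * V = 1 := Unitary.coe_star_mul_self _
  have hV2 : V * star V = 1 := Unitary.coe_mul_star_self _
  set D : Matrix (Fin n) (Fin n) ℂ := diagonal (RCLike.ofReal ∘ hq.eigenvalues)
  refine ⟨V * star U, ?_, ?_, ?_⟩
  · rw [star_mul, star_star]
    calc U * star V * (V * star U) = U * (star V * V) * star U := by noncomm_ring
      _ = 1 := by rw [hV1, mul_one, hU2]
  · rw [star_mul, star_star]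
    calc V * star U * (U * star V) = V * (star U * U) * star V := by noncomm_ring
      _ = 1 := by rw [hU1, mul_one, hV2]
  · calc V * star U * p = V * star U * (U * D * star U) := by rw [← h1]
      _ = V * (star U * U) * D * star U := by noncomm_ring
      _ = V * D * (star V * V) * star U := by rw [hU1, hV1, mul_one, mul_one]
      _ = (V * D * star V) * (V * star U) := by noncomm_ring
      _ = q * (V * star U) := by rw [← h2]

open Matrix in
theorem aux_intertwine {k n : ℕ} (hk : 0 < k)
    (f g : Matrix (Fin k) (Fin k) ℂ →⋆ₐ[ℂ] Matrix (Fin n) (Fin n) ℂ) :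
    ∃ u ∈ Matrix.unitaryGroup (Fin n) ℂ, ∀ x, u * f x * star u = g x := by
  let o : Fin k := ⟨0, hk⟩
  let E : Fin k → Fin k → Matrix (Fin k) (Fin k) ℂ := fun i j => single i j 1
  have hEE : ∀ i j l, E i j * E j l = E i l := by
    intro i j l; simp [E]
  have hE0 : ∀ i j j' l, j ≠ j' → E i j * E j' l = 0 := by
    intro i j j' l h; simp [E, h]
  have hEs : ∀ i j, star (E i j) = E j i := by
    intro i j; simp [E, star_eq_conjTranspose]
  have hE1 : ∑ i, E i i = 1 := by
    ext a b
    simp [E, Matrix.sum_apply, single_apply, one_apply, ite_and]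
  have htr : ∀ h : Matrix (Fin k) (Fin k) ℂ →⋆ₐ[ℂ] Matrix (Fin n) (Fin n) ℂ,
      (k : ℂ) * (h (E o o)).trace = n := by
    intro h
    have h1 : ∀ i, (h (E i i)).trace = (h (E o o)).trace := by
      intro i
      rw [← hEE i o i, map_mul, trace_mul_comm, ← map_mul, hEE]
    have h2 : (h (∑ i, E i i)).trace = n := by rw [hE1]; simp
    rw [map_sum, trace_sum, Finset.sum_congr rfl (fun i _ => h1 i)] at h2
    simpa using h2
  have hher : ∀ h : Matrix (Fin k) (Fin k) ℂ →⋆ₐ[ℂ] Matrix (Fin n) (Fin n) ℂ,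
      (h (E o o)).IsHermitian := by
    intro h
    change star (h (E o o)) = _
    rw [← map_star, hEs]
  have hk0 : (k : ℂ) ≠ 0 := by exact_mod_cast hk.ne'
  obtain ⟨v, hv1, hv2, hv⟩ := aux_proj_conj (f (E o o)) (g (E o o)) (hher f) (hher g)
    (by rw [← map_mul, hEE]) (by rw [← map_mul, hEE])
    (mul_left_cancel₀ hk0 ((htr f).trans (htr g).symm))
  let u : Matrix (Fin n) (Fin n) ℂ := ∑ i, g (E i o) * v * f (E o i)
  have hus : star u = ∑ i, f (E i o) * star v * g (E o i) := by
    simp only [u, star_sum, star_mul, ← map_star, hEs, mul_assoc]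
  have huu : u * star u = 1 := by
    rw [hus]
    simp only [u]
    rw [Finset.sum_mul_sum]
    have : ∀ i j, (g (E i o) * v * f (E o i)) * (f (E j o) * star v * g (E o j))
        = if i = j then g (E i i) else 0 := by
      intro i j
      have e : (g (E i o) * v * f (E o i)) * (f (E j o) * star v * g (E o j))
        = g (E i o) * v * f (E o i * E j o) * star v * g (E o j) := by
        rw [map_mul]; noncomm_ring
      rw [e]
      split_ifs with h
      · subst h
        rw [hEE, mul_assoc (g (E i o)), hv]
        calc g (E i o) * (g (E o o) * v) * star v * g (E o i)
            = g (E i o) * g (E o o) * (v * star v) * g (E o i) := by noncomm_ring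
          _ = g (E i i) := by rw [hv2, mul_one, ← map_mul, ← map_mul, hEE, hEE]
      · rw [hE0 _ _ _ _ h]; simp
    simp only [this]
    simp [← map_sum, hE1]
  have hus1 : star u * u = 1 := mul_eq_one_comm.mp huu
  have hcomm : ∀ a b, u * f (E a b) = g (E a b) * u := by
    intro a b
    have h1 : u * f (E a b) = g (E a o) * v * f (E o b) := by
      simp only [u, Finset.sum_mul]
      rw [Finset.sum_eq_single a]
      · rw [mul_assoc, ← map_mul, hEE]
      · intro i _ hi
        rw [mul_assoc, ← map_mul, hE0 _ _ _ _ hi]; simp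
      · simp
    have h2 : g (E a b) * u = g (E a o) * v * f (E o b) := by
      simp only [u, Finset.mul_sum]
      rw [Finset.sum_eq_single b]
      · rw [← mul_assoc, ← mul_assoc, ← map_mul, hEE]
      · intro i _ hi
        rw [← mul_assoc, ← mul_assoc, ← map_mul, hE0 _ _ _ _ hi.symm]; simp
      · simp
    rw [h1, h2]
  refine ⟨u, mem_unitaryGroup_iff.2 huu, fun x => ?_⟩
  have hx : x = ∑ a, ∑ b, x a b • E a b := by
    conv_lhs => rw [matrix_eq_sum_single x]
    simp [E, smul_single]
  have hc : u * f x = g x * u := by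
    rw [hx]
    simp only [map_sum, map_smul, Finset.mul_sum, Finset.sum_mul, mul_smul_comm, smul_mul_assoc,
      hcomm]
  rw [hc, mul_assoc, huu, mul_one]


/-- Any two star-closed unital subalgebras of `M_n(ℂ)` that are star-isomorphic to
`M_k(ℂ)` are conjugate by a unitary matrix. -/
theorem stmt_1 (k n : ℕ) (hk : 0 < k) (hn : 0 < n)
    (A B : StarSubalgebra ℂ (Matrix (Fin n) (Fin n) ℂ))
    (hA : Nonempty (Matrix (Fin k) (Fin k) ℂ ≃⋆ₐ[ℂ] A))
    (hB : Nonempty (Matrix (Fin k) (Fin k) ℂ ≃⋆ₐ[ℂ] B)) :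
    ∃ u ∈ Matrix.unitaryGroup (Fin n) ℂ,
      (B : Set (Matrix (Fin n) (Fin n) ℂ)) =
        (fun a => u * a * star u) '' (A : Set (Matrix (Fin n) (Fin n) ℂ)) := by
  obtain ⟨eA⟩ := hA
  obtain ⟨eB⟩ := hB
  obtain ⟨u, hu, h⟩ := aux_intertwine hk
    (A.subtype.comp (eA : Matrix (Fin k) (Fin k) ℂ →⋆ₐ[ℂ] A))
    (B.subtype.comp (eB : Matrix (Fin k) (Fin k) ℂ →⋆ₐ[ℂ] B))
  have h' : ∀ x, u * (eA x : Matrix (Fin n) (Fin n) ℂ) * star u = eB x := h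
  refine ⟨u, hu, Set.ext fun y => ⟨fun hy => ?_, ?_⟩⟩
  · refine ⟨eA (eB.symm ⟨y, hy⟩), (eA (eB.symm ⟨y, hy⟩)).2, ?_⟩
    simp only [h']
    simp
  · rintro ⟨x, hx, rfl⟩
    have := h' (eA.symm ⟨x, hx⟩)
    simp only [StarAlgEquiv.apply_symm_apply] at this
    simp only [this]
    exact (eB _).2
end

section
/- Let k, l be positive integers and let A be a unital ℂ-subalgebra of M_{kl}(ℂ), closed under conjugate transpose and isomorphic to M_k(ℂ) as a star-algebra (a k-subalgebra). Then the centralizer of A in M_{kl}(ℂ), i.e. { g ∈ M_{kl}(ℂ) : g * a = a * g for all a ∈ A }, is isomorphic as a ℂ-algebra to M_l(ℂ). (This is the paper's claim that the bundle of centralizers B_{k,l} over the matrix grassmannian has fiber M_l(ℂ).) -/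
lemma centralizer_aux_PQ {n l : ℕ} (e : Matrix (Fin n) (Fin n) ℂ) (he : e * e = e)
    (ht : e.trace = l) :
    ∃ (P : Matrix (Fin n) (Fin l) ℂ) (Q : Matrix (Fin l) (Fin n) ℂ), P * Q = e ∧ Q * P = 1 := by
  have hid : IsIdempotentElem (Matrix.toLin' e) := by
    unfold IsIdempotentElem
    rw [Module.End.mul_eq_comp, ← Matrix.toLin'_mul, he]
  have hp := LinearMap.isProj_range_iff_isIdempotentElem _ |>.2 hid
  have htr := hp.trace
  rw [Matrix.trace_toLin'_eq, ht] at htr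
  have hd : Module.finrank ℂ (LinearMap.range (Matrix.toLin' e)) = Module.finrank ℂ (Fin l → ℂ) := by
    rw [Module.finrank_fin_fun]; exact_mod_cast htr.symm
  let E := LinearEquiv.ofFinrankEq _ _ hd
  refine ⟨LinearMap.toMatrix' ((LinearMap.range (Matrix.toLin' e)).subtype ∘ₗ E.symm.toLinearMap),
    LinearMap.toMatrix' (E.toLinearMap ∘ₗ (Matrix.toLin' e).rangeRestrict), ?_, ?_⟩
  · rw [← LinearMap.toMatrix'_comp]
    conv_rhs => rw [← LinearMap.toMatrix'_toLin' e]
    congr 1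
    ext1 x
    ext; simp
  · rw [← LinearMap.toMatrix'_comp, ← LinearMap.toMatrix'_id]
    congr 1
    refine LinearMap.ext fun x => ?_
    have : (Matrix.toLin' e).rangeRestrict (E.symm x : Fin n → ℂ) = E.symm x := by
      apply Subtype.ext
      exact hp.map_id _ (E.symm x).2
    simp only [LinearMap.comp_apply, Submodule.subtype_apply, LinearEquiv.coe_coe, LinearMap.id_apply]
    rw [this]; simp

/-- The centralizer of a `k`-subalgebra of `M_{kl}(ℂ)` is isomorphic to `M_l(ℂ)`
as a `ℂ`-algebra. -/
theorem stmt_4 (k l : ℕ) (hk : 0 < k) (hl : 0 < l)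
    (A : StarSubalgebra ℂ (Matrix (Fin (k * l)) (Fin (k * l)) ℂ))
    (hA : Nonempty (Matrix (Fin k) (Fin k) ℂ ≃⋆ₐ[ℂ] A)) :
    Nonempty
      ((Subalgebra.centralizer ℂ (A : Set (Matrix (Fin (k * l)) (Fin (k * l)) ℂ))) ≃ₐ[ℂ]
        Matrix (Fin l) (Fin l) ℂ) := by
  obtain ⟨φ⟩ := hA
  let z : Fin k := ⟨0, hk⟩
  let e : Fin k → Fin k → Matrix (Fin (k * l)) (Fin (k * l)) ℂ :=
    fun i j => (φ (Matrix.single i j 1) : Matrix (Fin (k * l)) (Fin (k * l)) ℂ)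
  have emem : ∀ i j, e i j ∈ A := fun i j => (φ _).2
  have emul : ∀ i j m, e i j * e j m = e i m := by
    intro i j m
    simp only [e]
    rw [← MulMemClass.coe_mul, ← map_mul, Matrix.single_mul_single_same, one_mul]
  have emul0 : ∀ i j j' m, j ≠ j' → e i j * e j' m = 0 := by
    intro i j j' m h
    simp only [e]
    rw [← MulMemClass.coe_mul, ← map_mul, Matrix.single_mul_single_of_ne (h := h), map_zero]
    rfl
  have esum : ∑ i, e i i = 1 := by
    simp only [e]
    rw [← AddSubmonoidClass.coe_finsetSum, ← map_sum]
    have : ∑ i : Fin k, Matrix.single i i (1:ℂ) = 1 := Matrix.sum_single_one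
    rw [this, map_one]
    rfl
  have espan : ∀ a ∈ A, ∃ c : Matrix (Fin k) (Fin k) ℂ, a = ∑ i, ∑ j, c i j • e i j := by
    intro a ha
    refine ⟨φ.symm ⟨a, ha⟩, ?_⟩
    have h : a = (φ (φ.symm ⟨a, ha⟩) : Matrix (Fin (k * l)) (Fin (k * l)) ℂ) := by simp
    generalize φ.symm ⟨a, ha⟩ = c at h ⊢
    rw [h]
    conv_lhs => rw [Matrix.matrix_eq_sum_single c]
    have h1 : ∀ i j, Matrix.single i j (c i j) = c i j • Matrix.single i j (1:ℂ) := by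
      intro i j; simp
    simp only [h1, map_sum, map_smul, AddSubmonoidClass.coe_finsetSum, e]
    rfl
  have etr : (e z z).trace = l := by
    have h1 : ∀ i, (e i i).trace = (e z z).trace := by
      intro i
      rw [← emul i z i, Matrix.trace_mul_comm, emul]
    have h2 := congrArg Matrix.trace esum
    rw [Matrix.trace_sum, Finset.sum_congr rfl (fun i _ => h1 i)] at h2
    simp only [Finset.sum_const, Finset.card_univ, Fintype.card_fin, nsmul_eq_mul,
      Matrix.trace_one, Nat.cast_mul] at h2
    exact mul_left_cancel₀ (by exact_mod_cast hk.ne') h2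
  obtain ⟨P, Q, hPQ, hQP⟩ := centralizer_aux_PQ (e z z) (emul _ _ _) etr
  have hC : ∀ g, g ∈ Subalgebra.centralizer ℂ (A : Set (Matrix (Fin (k * l)) (Fin (k * l)) ℂ)) →
      ∀ i j, e i j * g = g * e i j := by
    intro g hg i j
    exact Subalgebra.mem_centralizer_iff ℂ |>.1 hg _ (emem i j)
  have heP : e z z * P = P := by rw [← hPQ, Matrix.mul_assoc, hQP, Matrix.mul_one]
  have hQe : Q * e z z = Q := by rw [← hPQ, ← Matrix.mul_assoc, hQP, Matrix.one_mul]
  let G : Matrix (Fin l) (Fin l) ℂ → Matrix (Fin (k * l)) (Fin (k * l)) ℂ :=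
    fun T => ∑ i, e i z * (P * T * Q) * e z i
  have hl1 : ∀ T a b, e a b * G T = e a z * (P * T * Q) * e z b := by
    intro T a b
    simp only [G]
    rw [Finset.mul_sum, Finset.sum_eq_single b]
    · rw [← mul_assoc, ← mul_assoc, emul]
    · intro i _ hi
      rw [← mul_assoc, ← mul_assoc, emul0 _ _ _ _ hi.symm]; simp
    · simp
  have hr1 : ∀ T a b, G T * e a b = e a z * (P * T * Q) * e z b := by
    intro T a b
    simp only [G]
    rw [Finset.sum_mul, Finset.sum_eq_single a]
    · rw [mul_assoc, emul]
    · intro i _ hi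
      rw [mul_assoc, emul0 _ _ _ _ hi]; simp
    · simp
  have hG : ∀ T, G T ∈ Subalgebra.centralizer ℂ (A : Set (Matrix (Fin (k * l)) (Fin (k * l)) ℂ)) := by
    intro T
    rw [Subalgebra.mem_centralizer_iff]
    intro a ha
    obtain ⟨c, rfl⟩ := espan a ha
    simp only [Finset.sum_mul, Finset.mul_sum, smul_mul_assoc, mul_smul_comm, hl1, hr1]
  let F : Subalgebra.centralizer ℂ (A : Set (Matrix (Fin (k * l)) (Fin (k * l)) ℂ)) →ₐ[ℂ]
      Matrix (Fin l) (Fin l) ℂ := AlgHom.ofLinearMap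
    { toFun := fun g => Q * g.1 * P
      map_add' := by intro x y; simp [Matrix.mul_add, Matrix.add_mul]
      map_smul' := by intro c x; simp }
    (by simp [hQP])
    (by
      intro x y
      have hy := hC y.1 y.2 z z
      calc Q * (x.1 * y.1) * P = Q * (x.1 * y.1) * (e z z * P) := by rw [heP]
        _ = Q * x.1 * (y.1 * e z z) * P := by simp only [Matrix.mul_assoc]
        _ = Q * x.1 * ((P * Q) * y.1) * P := by rw [← hy, hPQ]
        _ = (Q * x.1 * P) * (Q * y.1 * P) := by simp only [Matrix.mul_assoc])
  refine ⟨AlgEquiv.ofBijective F ⟨?_, ?_⟩⟩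
  · have hGF : ∀ g, G (F g) = g.1 := by
      intro g
      have h1 : ∀ i, e i z * (P * F g * Q) * e z i = g.1 * e i i := by
        intro i
        calc e i z * (P * (Q * g.1 * P) * Q) * e z i
            = e i z * ((P * Q) * g.1 * (P * Q)) * e z i := by simp only [Matrix.mul_assoc]
          _ = g.1 * e i i := by
            rw [hPQ, hC g.1 g.2, mul_assoc g.1, emul, ← mul_assoc, hC g.1 g.2, mul_assoc g.1,
              emul, mul_assoc, emul]
      simp only [G]
      rw [Finset.sum_congr rfl (fun i _ => h1 i), ← Finset.mul_sum, esum, mul_one]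
    intro g h hgh
    apply Subtype.ext
    rw [← hGF g, hgh, hGF]
  · intro T
    refine ⟨⟨G T, hG T⟩, ?_⟩
    calc Q * G T * P = Q * (e z z * G T) * P := by rw [← Matrix.mul_assoc Q, hQe]
      _ = (Q * e z z) * (P * T * Q) * (e z z * P) := by rw [hl1]; simp only [Matrix.mul_assoc]
      _ = (Q * P) * T * (Q * P) := by rw [hQe, heP]; simp only [Matrix.mul_assoc]
      _ = T := by rw [hQP]; simp
end

section
/- Let m, n be positive integers, let A be a unital ℂ-subalgebra of M_m(ℂ) and B a unital ℂ-subalgebra of M_n(ℂ). Identify M_{mn}(ℂ) with matrices indexed by Fin m × Fin n via the Kronecker product. Then the centralizer in M_{mn}(ℂ) of the set { a ⊗ b : a ∈ A, b ∈ B } equals the linear span of { c ⊗ d : c ∈ Z(A), d ∈ Z(B) }, where Z(A) is the centralizer of A in M_m(ℂ) and Z(B) is the centralizer of B in M_n(ℂ). (This is the identity Z_{B⊗Ψ}(f(A) ⊗ g(Φ)) = Z_B(f(A)) ⊗ Z_Ψ(g(Φ)) used by the paper to establish naturality of the H-space structure on matrix grassmannians.) -/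
open Kronecker

/-- Coordinates of a linear projection onto a subspace of matrices. -/
lemma exists_proj_coords {k : ℕ} (V : Submodule ℂ (Matrix (Fin k) (Fin k) ℂ)) :
    ∃ P : Fin k → Fin k → Matrix (Fin k) (Fin k) ℂ, (∀ i j, P i j ∈ V) ∧
      ∀ X ∈ V, X = ∑ i, ∑ j, X i j • P i j := by
  obtain ⟨f, hf⟩ := LinearMap.exists_leftInverse_of_injective V.subtype V.ker_subtype
  refine ⟨fun i j => (f (Matrix.single i j 1) : Matrix (Fin k) (Fin k) ℂ),
    fun i j => (f _).2, fun X hX => ?_⟩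
  have h1 : f X = ⟨X, hX⟩ := LinearMap.congr_fun hf ⟨X, hX⟩
  have h2 : X = ∑ i, ∑ j, X i j • Matrix.single i j (1 : ℂ) := by
    conv_lhs => rw [Matrix.matrix_eq_sum_single X]
    simp [Matrix.smul_single]
  have h3 : (f X : Matrix (Fin k) (Fin k) ℂ) = X := by rw [h1]
  conv_lhs => rw [← h3, h2]
  simp only [map_sum, map_smul, Submodule.coe_sum, Submodule.coe_smul]

/-- `Z(A ⊗ B) = Z(A) ⊗ Z(B)`: the centralizer of `{a ⊗ b : a ∈ A, b ∈ B}` in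
`M_{mn}(ℂ)` is the linear span of `{c ⊗ d : c ∈ Z(A), d ∈ Z(B)}`. -/
theorem stmt_5 (m n : ℕ) (hm : 0 < m) (hn : 0 < n)
    (A : Subalgebra ℂ (Matrix (Fin m) (Fin m) ℂ))
    (B : Subalgebra ℂ (Matrix (Fin n) (Fin n) ℂ)) :
    Subalgebra.toSubmodule
        (Subalgebra.centralizer ℂ
          {x : Matrix (Fin m × Fin n) (Fin m × Fin n) ℂ | ∃ a ∈ A, ∃ b ∈ B, x = a ⊗ₖ b}) =
      Submodule.span ℂ
        {x : Matrix (Fin m × Fin n) (Fin m × Fin n) ℂ |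
          ∃ c ∈ Subalgebra.centralizer ℂ (A : Set (Matrix (Fin m) (Fin m) ℂ)),
            ∃ d ∈ Subalgebra.centralizer ℂ (B : Set (Matrix (Fin n) (Fin n) ℂ)),
              x = c ⊗ₖ d} := by
  apply le_antisymm
  · intro x hx
    rw [Subalgebra.mem_toSubmodule, Subalgebra.mem_centralizer_iff] at hx
    obtain ⟨P, hP, hPX⟩ := exists_proj_coords (Subalgebra.toSubmodule
      (Subalgebra.centralizer ℂ (A : Set (Matrix (Fin m) (Fin m) ℂ))))
    obtain ⟨Q, hQ, hQX⟩ := exists_proj_coords (Subalgebra.toSubmodule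
      (Subalgebra.centralizer ℂ (B : Set (Matrix (Fin n) (Fin n) ℂ))))
    have hA : ∀ k l, (Matrix.of fun i j => x (i, k) (j, l)) ∈ Subalgebra.toSubmodule
        (Subalgebra.centralizer ℂ (A : Set (Matrix (Fin m) (Fin m) ℂ))) := by
      intro k l
      rw [Subalgebra.mem_toSubmodule, Subalgebra.mem_centralizer_iff]
      intro a ha
      have h := hx _ ⟨a, ha, 1, B.one_mem, rfl⟩
      ext i j
      have h' := congrFun (congrFun h (i, k)) (j, l)
      simpa [Matrix.mul_apply, Fintype.sum_prod_type, Matrix.one_apply] using h'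
    have hB : ∀ i j, (Matrix.of fun k l => x (i, k) (j, l)) ∈ Subalgebra.toSubmodule
        (Subalgebra.centralizer ℂ (B : Set (Matrix (Fin n) (Fin n) ℂ))) := by
      intro i j
      rw [Subalgebra.mem_toSubmodule, Subalgebra.mem_centralizer_iff]
      intro b hb
      have h := hx _ ⟨1, A.one_mem, b, hb, rfl⟩
      ext k l
      have h' := congrFun (congrFun h (i, k)) (j, l)
      simpa [Matrix.mul_apply, Fintype.sum_prod_type_right, Matrix.one_apply] using h'
    have key : x = ∑ i, ∑ j, ∑ k, ∑ l, x (i, k) (j, l) • (P i j ⊗ₖ Q k l) := by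
      ext ⟨i, k⟩ ⟨j, l⟩
      have e1 := congrFun (congrFun (hPX _ (hA k l)) i) j
      simp only [Matrix.sum_apply, Matrix.smul_apply, Matrix.of_apply, smul_eq_mul] at e1
      simp only [Matrix.sum_apply, Matrix.smul_apply, smul_eq_mul, Matrix.kroneckerMap_apply]
      rw [e1]
      refine Finset.sum_congr rfl fun i' _ => Finset.sum_congr rfl fun j' _ => ?_
      have e2 := congrFun (congrFun (hQX _ (hB i' j')) k) l
      simp only [Matrix.sum_apply, Matrix.smul_apply, Matrix.of_apply, smul_eq_mul] at e2
      rw [e2, Finset.sum_mul]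
      refine Finset.sum_congr rfl fun k' _ => ?_
      rw [Finset.sum_mul]
      refine Finset.sum_congr rfl fun l' _ => ?_
      ring
    rw [key]
    exact Submodule.sum_mem _ fun i _ => Submodule.sum_mem _ fun j _ =>
      Submodule.sum_mem _ fun k _ => Submodule.sum_mem _ fun l _ =>
        Submodule.smul_mem _ _ (Submodule.subset_span ⟨_, hP i j, _, hQ k l, rfl⟩)
  · rw [Submodule.span_le]
    rintro _ ⟨c, hc, d, hd, rfl⟩
    rw [Subalgebra.mem_centralizer_iff] at hc hd
    rw [SetLike.mem_coe, Subalgebra.mem_toSubmodule, Subalgebra.mem_centralizer_iff]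
    rintro _ ⟨a, ha, b, hb, rfl⟩
    rw [← Matrix.mul_kronecker_mul, ← Matrix.mul_kronecker_mul, hc a ha, hd b hb]
end

section
/- Let k, l, N be positive integers and let β be a (k·l)-frame in M_N(ℂ), with frame indices reindexed via a bijection Fin(k·l) ≃ Fin k × Fin l. Then the matrices π₁(β) i j and π₂(β) p q commute for all indices, and π₁(β) i j * π₂(β) p q = β (i,p) (j,q) for all i, j, p, q. (This is the paper's identity β = π₁^m(β) · π₂^{r-m}(β) for any k^r-frame β.) -/
open Matrix

/-- A `k`-frame in a matrix algebra: a family `α i j` satisfying the matrix-unit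
relations, summing to the identity, and star-closed (`(α i j)ᴴ = α j i`). -/
def IsMatrixFrame {N : Type*} [Fintype N] [DecidableEq N] {ι : Type*} [Fintype ι]
    [DecidableEq ι] (α : ι → ι → Matrix N N ℂ) : Prop :=
  (∀ i j r s : ι, α i j * α r s = if j = r then α i s else 0) ∧
  (∑ i, α i i = 1) ∧
  (∀ i j : ι, (α i j)ᴴ = α j i)

/-- For a `(k·l)`-frame `β`, the matrices `π₁(β) i j` and `π₂(β) p q` commute and
`π₁(β) i j * π₂(β) p q = β (i,p) (j,q)`, i.e. `β = π₁(β) · π₂(β)`. -/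
theorem stmt_12 (k l N : ℕ) (hk : 0 < k) (hl : 0 < l) (hN : 0 < N)
    (β : (Fin k × Fin l) → (Fin k × Fin l) → Matrix (Fin N) (Fin N) ℂ)
    (hβ : IsMatrixFrame β) :
    (∀ (i j : Fin k) (p q : Fin l),
        (∑ p' : Fin l, β (i, p') (j, p')) * (∑ i' : Fin k, β (i', p) (i', q)) =
          (∑ i' : Fin k, β (i', p) (i', q)) * (∑ p' : Fin l, β (i, p') (j, p'))) ∧
      (∀ (i j : Fin k) (p q : Fin l),
        (∑ p' : Fin l, β (i, p') (j, p')) * (∑ i' : Fin k, β (i', p) (i', q)) =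
          β (i, p) (j, q)) := by
  have h1 : ∀ (i j : Fin k) (p q : Fin l),
        (∑ p' : Fin l, β (i, p') (j, p')) * (∑ i' : Fin k, β (i', p) (i', q)) =
          β (i, p) (j, q) := by
    intro i j p q
    simp only [Finset.sum_mul_sum, hβ.1, Prod.mk.injEq, ite_and]
    simp
  have h2 : ∀ (i j : Fin k) (p q : Fin l),
        (∑ i' : Fin k, β (i', p) (i', q)) * (∑ p' : Fin l, β (i, p') (j, p')) =
          β (i, p) (j, q) := by
    intro i j p q
    simp only [Finset.sum_mul_sum, hβ.1, Prod.mk.injEq, ite_and]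
    simp
  exact ⟨fun i j p q => (h1 i j p q).trans (h2 i j p q).symm, h1⟩
end

section
/- Let k, l be positive integers. The set of all k-frames in M_{kl}(ℂ), regarded as a subset of the product space (Fin k × Fin k) → M_{kl}(ℂ) with its natural topology, is path-connected (in particular nonempty). (This underlies the paper's assertion that π₀(Fr_{kl^∞, l^∞}) = 0, so that the monoid Fr_{kl^∞, l^∞} is grouplike.) -/
open Matrix

/-- A projection of trace `l` is `W * Wᴴ` for an isometry `W`. -/
lemma exists_isometry_of_proj {n : Type*} [Fintype n] [DecidableEq n] (P : Matrix n n ℂ)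
    (hP : Pᴴ = P) (hPP : P * P = P) (l : ℕ) (ht : P.trace = l) :
    ∃ W : Matrix n (Fin l) ℂ, W * Wᴴ = P ∧ Wᴴ * W = 1 := by
  have hA : P.IsHermitian := hP
  obtain ⟨V, hV⟩ : ∃ V : Matrix n n ℂ, V = hA.eigenvectorUnitary := ⟨_, rfl⟩
  have hV1 : V * Vᴴ = 1 := by
    rw [hV]; exact Unitary.coe_mul_star_self hA.eigenvectorUnitary
  have hV2 : Vᴴ * V = 1 := mul_eq_one_comm.mp hV1
  have hs : P = V * diagonal (fun i => (hA.eigenvalues i : ℂ)) * Vᴴ := by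
    conv_lhs => rw [hA.spectral_theorem, Unitary.conjStarAlgAut_apply]
    rw [hV]; rfl
  generalize hA.eigenvalues = d at hs
  have hD : diagonal (fun i => (d i : ℂ)) = Vᴴ * P * V := by
    rw [hs]
    calc _ = (Vᴴ * V) * diagonal (fun i => (d i : ℂ)) * (Vᴴ * V) := by simp [hV2]
      _ = _ := by simp only [Matrix.mul_assoc]
  have hDD : diagonal (fun i => (d i : ℂ)) * diagonal (fun i => (d i : ℂ))
      = diagonal (fun i => (d i : ℂ)) := by
    rw [hD]
    calc _ = Vᴴ * P * (V * Vᴴ) * P * V := by simp only [Matrix.mul_assoc]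
      _ = Vᴴ * (P * P) * V := by rw [hV1]; simp only [Matrix.mul_assoc, Matrix.one_mul]
      _ = _ := by rw [hPP]
  have hd : ∀ i, d i = 0 ∨ d i = 1 := by
    intro i
    rw [diagonal_mul_diagonal] at hDD
    have h := congrFun (diagonal_injective hDD) i
    have h' : d i * d i = d i := by exact_mod_cast h
    have : d i * (d i - 1) = 0 := by linarith
    rcases mul_eq_zero.mp this with h | h
    · exact Or.inl h
    · exact Or.inr (by linarith)
  have hd' : ∀ i, (d i : ℂ) = if d i = 1 then 1 else 0 := by
    intro i
    rcases hd i with h | h <;> simp [h]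
  have hcard : Fintype.card {i // d i = 1} = l := by
    have h1 : P.trace = ∑ i, (d i : ℂ) := by
      rw [hs, Matrix.trace_mul_comm, ← Matrix.mul_assoc, hV2, Matrix.one_mul, trace_diagonal]
    rw [ht] at h1
    simp_rw [hd'] at h1
    rw [Finset.sum_boole] at h1
    rw [Fintype.card_subtype]
    exact_mod_cast h1.symm
  let e : Fin l ≃ {i // d i = 1} := (Fintype.equivFinOfCardEq hcard).symm
  refine ⟨V.submatrix id (fun a => (e a).1), ?_, ?_⟩
  · ext i j
    rw [hs, Matrix.mul_apply, Matrix.mul_apply]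
    simp only [mul_diagonal, conjTranspose_apply, submatrix_apply, id]
    rw [e.sum_comp (fun s : {i // d i = 1} => V i s.1 * star (V j s.1))]
    rw [← Finset.sum_subtype (Finset.univ.filter (fun i => d i = 1)) (by simp)
      (fun s => V i s * star (V j s)), Finset.sum_filter]
    refine Finset.sum_congr rfl fun x _ => ?_
    rcases hd x with h | h <;> simp [h]
  · have : (V.submatrix id (fun a => (e a).1))ᴴ * V.submatrix id (fun a => (e a).1)
        = (Vᴴ * V).submatrix (fun a => (e a).1) (fun a => (e a).1) := by
      ext i j
      simp [Matrix.mul_apply]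
    rw [this, hV2]
    exact submatrix_one _ (Subtype.val_injective.comp e.injective)

lemma frame_isometry (k l : ℕ) (hk : 0 < k)
    (α : Fin k → Fin k → Matrix (Fin (k * l)) (Fin (k * l)) ℂ) (h : IsMatrixFrame α) :
    ∃ W : Matrix (Fin (k * l)) (Fin l) ℂ, W * Wᴴ = α ⟨0, hk⟩ ⟨0, hk⟩ ∧ Wᴴ * W = 1 := by
  obtain ⟨h1, h2, h3⟩ := h
  refine exists_isometry_of_proj _ (h3 _ _) (by simp [h1]) l ?_
  have h4 : ∀ i, (α i i).trace = (α ⟨0, hk⟩ ⟨0, hk⟩).trace := by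
    intro i
    have e1 : α i i = α i ⟨0, hk⟩ * α ⟨0, hk⟩ i := by simp [h1]
    rw [e1, trace_mul_comm, h1]; simp
  have h5 := congrArg trace h2
  rw [trace_sum, Finset.sum_congr rfl (fun i _ => h4 i)] at h5
  simp only [Finset.sum_const, Finset.card_univ, Fintype.card_fin, trace_one, nsmul_eq_mul,
    Nat.cast_mul] at h5
  exact mul_left_cancel₀ (by exact_mod_cast hk.ne') h5

lemma frame_conj (k l : ℕ) (hk : 0 < k)
    (α β : Fin k → Fin k → Matrix (Fin (k * l)) (Fin (k * l)) ℂ)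
    (hα : IsMatrixFrame α) (hβ : IsMatrixFrame β) :
    ∃ U : Matrix (Fin (k * l)) (Fin (k * l)) ℂ, U * Uᴴ = 1 ∧
      ∀ i j, U * α i j * Uᴴ = β i j := by
  obtain ⟨A, hA, hA'⟩ := frame_isometry k l hk α hα
  obtain ⟨B, hB, hB'⟩ := frame_isometry k l hk β hβ
  obtain ⟨a1, a2, a3⟩ := hα
  obtain ⟨b1, b2, b3⟩ := hβ
  generalize (⟨0, hk⟩ : Fin k) = o at *
  have key : B * Aᴴ * α o o * A * Bᴴ = β o o := by
    calc _ = B * (Aᴴ * A) * (Aᴴ * A) * Bᴴ := by rw [← hA]; simp only [Matrix.mul_assoc]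
      _ = _ := by rw [hA', Matrix.mul_one, Matrix.mul_one, hB]
  let U : Matrix (Fin (k * l)) (Fin (k * l)) ℂ := ∑ i, β i o * B * Aᴴ * α o i
  have hU : Uᴴ = ∑ i, α i o * A * Bᴴ * β o i := by
    simp only [U, conjTranspose_sum, conjTranspose_mul, conjTranspose_conjTranspose, a3, b3,
      Matrix.mul_assoc]
  have hL : ∀ i j, U * α i j = β i o * B * Aᴴ * α o j := by
    intro i j
    simp only [U, Finset.sum_mul, Matrix.mul_assoc, a1]
    rw [Finset.sum_eq_single i] <;> simp +contextual
  have hc : ∀ i j, U * α i j * Uᴴ = β i j := by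
    intro i j
    rw [hL, hU, Finset.mul_sum, Finset.sum_eq_single j]
    · calc _ = β i o * B * Aᴴ * (α o j * α j o) * A * Bᴴ * β o j := by
            simp only [Matrix.mul_assoc]
        _ = β i o * (B * Aᴴ * α o o * A * Bᴴ) * β o j := by
            rw [a1]; simp only [Matrix.mul_assoc, if_true]
        _ = _ := by rw [key]; simp [b1]
    · intro r _ hr
      calc _ = β i o * B * Aᴴ * (α o j * α r o) * A * Bᴴ * β o r := by
            simp only [Matrix.mul_assoc]
        _ = 0 := by rw [a1]; simp [hr.symm]
    · simp
  refine ⟨U, ?_, hc⟩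
  calc U * Uᴴ = U * (∑ i, α i i) * Uᴴ := by rw [a2, Matrix.mul_one]
    _ = ∑ i, U * α i i * Uᴴ := by rw [Finset.mul_sum, Finset.sum_mul]
    _ = 1 := by simp only [hc, b2]

lemma frame_conj_frame {n ι : Type*} [Fintype n] [DecidableEq n] [Fintype ι] [DecidableEq ι]
    (α : ι → ι → Matrix n n ℂ) (hα : IsMatrixFrame α) (U : Matrix n n ℂ) (hU : U * Uᴴ = 1) :
    IsMatrixFrame (fun i j => U * α i j * Uᴴ) := by
  have hU' : Uᴴ * U = 1 := mul_eq_one_comm.mp hU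
  obtain ⟨a1, a2, a3⟩ := hα
  refine ⟨fun i j r s => ?_, ?_, fun i j => ?_⟩
  · calc _ = U * α i j * (Uᴴ * U) * α r s * Uᴴ := by simp only [Matrix.mul_assoc]
      _ = U * (α i j * α r s) * Uᴴ := by rw [hU']; simp only [Matrix.mul_assoc, Matrix.one_mul]
      _ = _ := by rw [a1]; split_ifs <;> simp
  · rw [← Finset.sum_mul, ← Finset.mul_sum, a2, Matrix.mul_one, hU]
  · simp only [conjTranspose_mul, conjTranspose_conjTranspose, a3, Matrix.mul_assoc]

/-- The standard frame. -/
lemma exists_frame (k l : ℕ) :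
    ∃ α : Fin k → Fin k → Matrix (Fin (k * l)) (Fin (k * l)) ℂ, IsMatrixFrame α := by
  refine ⟨fun i j => reindexAlgEquiv ℂ ℂ finProdFinEquiv
    (kroneckerMap (· * ·) (single i j (1 : ℂ)) (1 : Matrix (Fin l) (Fin l) ℂ)), ?_, ?_, ?_⟩
  · intro i j r s
    rw [← map_mul, ← mul_kronecker_mul]
    split_ifs with h
    · subst h; simp
    · simp [single_mul_single_of_ne, h]
  · rw [← map_sum]
    have : ∑ i : Fin k, kroneckerMap (· * ·) (single i i (1 : ℂ)) (1 : Matrix (Fin l) (Fin l) ℂ)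
        = 1 := by
      rw [← one_kronecker_one]
      ext a b
      have h : ∑ c : Fin k, single c c (1 : ℂ) a.1 b.1 = (1 : Matrix (Fin k) (Fin k) ℂ) a.1 b.1 := by
        rw [← sum_single_one, Matrix.sum_apply]
      rw [Matrix.sum_apply]
      simp only [kroneckerMap_apply]
      rw [← Finset.sum_mul, h]
    rw [this, map_one]
  · intro i j
    simp only [coe_reindexAlgEquiv, conjTranspose_reindex, conjTranspose_kronecker,
      conjTranspose_single, conjTranspose_one, star_one]

open scoped Matrix.Norms.L2Operator in
/-- Up to a phase, every unitary matrix is joined to `1` by a path of unitaries. -/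
lemma unitary_path {n : Type*} [Fintype n] [DecidableEq n] (U : Matrix n n ℂ)
    (hU : U * Uᴴ = 1) :
    ∃ (z : ℂ) (γ : unitInterval → Matrix n n ℂ), z * star z = 1 ∧ Continuous γ ∧ γ 0 = 1 ∧
      γ 1 = z • U ∧ ∀ t, γ t * (γ t)ᴴ = 1 := by
  have hU' : Uᴴ * U = 1 := mul_eq_one_comm.mp hU
  have hfin := U.finite_spectrum
  have hinf : (Metric.sphere (0 : ℂ) 1).Infinite := by
    refine (isPreconnected_sphere (by simp [Complex.rank_real_complex]) 0 1).infinite_of_nontrivial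
      ⟨1, by simp, -1, by simp, ?_⟩
    norm_num [Complex.ext_iff]
  obtain ⟨w, hw, hwU⟩ := hinf.exists_notMem_finite hfin
  have hw1 : w * star w = 1 := by
    have : ‖w‖ = 1 := by simpa using hw
    rw [Complex.star_def, Complex.mul_conj, Complex.normSq_eq_norm_sq, this]; simp
  have hw0 : w ≠ 0 := by rintro rfl; simp at hw1
  have hz : (-star w) * star (-star w) = 1 := by simpa [mul_comm] using hw1
  have hun : (-star w) • U ∈ unitary (Matrix n n ℂ) := by
    rw [Unitary.mem_iff]
    simp only [star_smul, star_eq_conjTranspose, smul_mul_smul_comm, hU, hU']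
    rw [mul_comm (star _), hz]; simp
  have hspec : (-1 : ℂ) ∉ spectrum ℂ ((-star w) • U) := by
    intro h
    apply hwU
    rw [spectrum.mem_iff] at h ⊢
    contrapose! h
    have e : algebraMap ℂ (Matrix n n ℂ) (-1) - (-star w) • U
        = (Units.mk0 (-star w) (by simpa using hw0)) • (algebraMap ℂ (Matrix n n ℂ) w - U) := by
      rw [Units.smul_def, Units.val_mk0, smul_sub, Algebra.algebraMap_eq_smul_one,
        Algebra.algebraMap_eq_smul_one, smul_smul, neg_mul, mul_comm, hw1]
    rw [e]
    exact h.smul _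
  have hn := (Unitary.norm_sub_one_lt_two_iff hun).2 hspec
  let γ := Unitary.path (1 : unitary (Matrix n n ℂ)) ⟨_, hun⟩ hn
  refine ⟨-star w, fun t => (γ t : Matrix n n ℂ), hz, ?_, ?_, ?_, fun t => ?_⟩
  · exact continuous_subtype_val.comp γ.continuous
  · simp
  · simp
  · exact Unitary.coe_mul_star_self (γ t)

/-- The space of `k`-frames in `M_{kl}(ℂ)`, as a subspace of the product space of
all families `Fin k → Fin k → M_{kl}(ℂ)`, is path-connected (hence nonempty). -/
theorem stmt_17 (k l : ℕ) (hk : 0 < k) (hl : 0 < l) :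
    IsPathConnected
      {α : Fin k → Fin k → Matrix (Fin (k * l)) (Fin (k * l)) ℂ | IsMatrixFrame α} := by
  obtain ⟨α, hα⟩ := exists_frame k l
  refine ⟨α, hα, fun {β} hβ => ?_⟩
  obtain ⟨U, hU, hc⟩ := frame_conj k l hk α β hα hβ
  obtain ⟨z, γ, hz, hγ, h0, h1, hu⟩ := unitary_path U hU
  refine ⟨⟨⟨fun t i j => γ t * α i j * (γ t)ᴴ, ?_⟩, ?_, ?_⟩, fun t => ?_⟩
  · refine continuous_pi fun i => continuous_pi fun j => ?_
    exact (hγ.matrix_mul continuous_const).matrix_mul hγ.matrix_conjTranspose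
  · funext i j
    simp [h0]
  · funext i j
    simp only [h1, conjTranspose_smul, Matrix.smul_mul, Matrix.mul_smul, smul_smul, hc]
    rw [mul_comm (star z), hz, one_smul]
  · exact frame_conj_frame α hα (γ t) (hu t)
end
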